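/- arXiv:1808.10241 — 4 statements merged into one kernel-verified Lean document; each statement's English description precedes it below -/
import Mathlib

section
/- Let S, T ⊆ ℝⁿ be two bounded sets with S \ T ≠ ∅, and suppose that S \ T contains a nonempty open subset of ℝⁿ. Then there exists a real polynomial p ∈ ℝ[x₁, …, xₙ] such that p(y) ≥ 0 for all y ∈ T and ∫_S p(x) dμ < 0, where μ denotes the Lebesgue measure on ℝⁿ. -/
/-- **Weierstrass approximation** in several variables: on a compact set, a continuous function is
uniformly approximated by polynomials. -/
theorem MvPolynomial.exists_eval_near_of_isCompact {σ : Type*} (f : C(σ → ℝ, ℝ))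
    {K : Set (σ → ℝ)} (hK : IsCompact K) {δ : ℝ} (hδ : 0 < δ) :
    ∃ p : MvPolynomial σ ℝ, ∀ x ∈ K, |MvPolynomial.eval x p - f x| < δ := by
  let coord (i : σ) : C(σ → ℝ, ℝ) := ⟨fun x => x i, continuous_apply i⟩
  have eval_coord (p : MvPolynomial σ ℝ) (x : σ → ℝ) :
      MvPolynomial.aeval coord p x = MvPolynomial.eval x p := by
    induction p using MvPolynomial.induction_on with
    | C a => simp
    | add p q hp hq => simp [hp, hq]
    | mul_X p i hp => simp [hp, coord]
  have hsep : (MvPolynomial.aeval (R := ℝ) coord).range.SeparatesPoints := by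
    intro x y hxy
    obtain ⟨i, hi⟩ := Function.ne_iff.mp hxy
    exact ⟨coord i, ⟨coord i, ⟨MvPolynomial.X i, by simp⟩, rfl⟩, hi⟩
  obtain ⟨g, ⟨p, rfl⟩, hg⟩ :=
    ContinuousMap.exists_mem_subalgebra_near_continuous_of_isCompact_of_separatesPoints
      hsep f hK hδ
  refine ⟨p, fun x hx => ?_⟩
  rw [← eval_coord]
  exact hg x hx

open MeasureTheory

/-- If `S, T ⊆ ℝⁿ` are bounded, `S \ T ≠ ∅`, and `S \ T` contains a nonempty open
subset, then there is a real polynomial `p` in `n` variables that is nonnegative on `T` and whose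
Lebesgue integral over `S` is negative. -/
theorem stmt2 (n : ℕ) (S T : Set (Fin n → ℝ))
    (hS : Bornology.IsBounded S) (hT : Bornology.IsBounded T)
    (hne : (S \ T).Nonempty)
    (hopen : ∃ V : Set (Fin n → ℝ), IsOpen V ∧ V.Nonempty ∧ V ⊆ S \ T) :
    ∃ p : MvPolynomial (Fin n) ℝ,
      (∀ y ∈ T, 0 ≤ MvPolynomial.eval y p) ∧
      (∫ x in S, MvPolynomial.eval x p ∂volume) < 0 := by
  obtain ⟨V, hVo, ⟨x₀, hx₀⟩, hV⟩ := hopen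
  obtain ⟨ε, hε, hball⟩ := Metric.isOpen_iff.mp hVo x₀ hx₀
  let K := closure (S ∪ T)
  have hK : IsCompact K := (hS.union hT).isCompact_closure
  have hSK : S ⊆ K := Set.subset_union_left.trans subset_closure
  have hTK : T ⊆ K := Set.subset_union_right.trans subset_closure
  have hfin : IsFiniteMeasure (volume.restrict S) := ⟨by simpa using hS.measure_lt_top⟩
  have haeK : ∀ᵐ x ∂volume.restrict S, x ∈ K :=
    ae_restrict_of_ae_restrict_of_subset hSK (ae_restrict_mem hK.measurableSet)
  have integrable_of_continuous {h : (Fin n → ℝ) → ℝ} (hh : Continuous h) :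
      Integrable h (volume.restrict S) :=
    (hh.continuousOn.integrableOn_compact hK).mono_set hSK
  let g : C(Fin n → ℝ, ℝ) := ⟨fun x => max 0 (ε - dist x x₀), by fun_prop⟩
  have hg0 : ∀ x, 0 ≤ g x := fun x => le_max_left _ _
  have hgT : ∀ y ∈ T, g y = 0 := fun y hy =>
    max_eq_left (sub_nonpos.mpr (not_lt.mp fun h => (hV (hball h)).2 hy))
  have hgi : Integrable g (volume.restrict S) := integrable_of_continuous g.continuous
  have hgpos : 0 < ∫ x in S, g x := by
    rw [integral_pos_iff_support_of_nonneg hg0 hgi]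
    have hsub : Metric.ball x₀ ε ⊆ Function.support g := fun x hx =>
      (lt_max_of_lt_right (sub_pos.mpr hx)).ne'
    refine lt_of_lt_of_le ?_ (measure_mono hsub)
    rw [Measure.restrict_apply Metric.isOpen_ball.measurableSet,
      Set.inter_eq_left.mpr fun x hx => (hV (hball hx)).1]
    exact Metric.measure_ball_pos _ _ hε
  set m := (volume.restrict S).real Set.univ with hm
  have hm0 : 0 ≤ m := measureReal_nonneg
  obtain ⟨δ, hδ, hδm⟩ : ∃ δ > 0, m * (2 * δ) < ∫ x in S, g x := by
    refine ⟨(∫ x in S, g x) / (2 * (m + 1)), by positivity, ?_⟩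
    have : m * (2 * ((∫ x in S, g x) / (2 * (m + 1)))) = (∫ x in S, g x) * (m / (m + 1)) := by
      field_simp
    rw [this]
    exact mul_lt_of_lt_one_right hgpos ((div_lt_one (by positivity)).mpr (by linarith))
  obtain ⟨p, hp⟩ := MvPolynomial.exists_eval_near_of_isCompact
    (ContinuousMap.const _ δ - g) hK hδ
  simp only [ContinuousMap.sub_apply, ContinuousMap.const_apply, abs_lt] at hp
  refine ⟨p, fun y hy => ?_, ?_⟩
  · have := (hp y (hTK hy)).1
    rw [hgT y hy] at this
    linarith
  · calc ∫ x in S, MvPolynomial.eval x p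
        ≤ ∫ x in S, (2 * δ - g x) := by
          refine integral_mono_ae (integrable_of_continuous p.continuous_eval)
            ((integrable_const _).sub hgi) ?_
          filter_upwards [haeK] with x hx
          linarith [(hp x hx).2]
      _ = m * (2 * δ) - ∫ x in S, g x := by
          rw [integral_sub (integrable_const _) hgi, integral_const, smul_eq_mul]
      _ < 0 := by linarith
end

section
/- Let n ≥ 1 and let 0 < r < R be real numbers. Then there exists a real polynomial p ∈ ℝ[x₁, …, xₙ] such that p(x) ≥ 0 for all x ∈ ℝⁿ with r ≤ ‖x‖ ≤ R, and ∫_{B_R(0)} p(x) dμ < 0, where B_R(0) is the Euclidean ball of radius R centered at the origin and μ is the Lebesgue measure on ℝⁿ. -/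
open MeasureTheory

/-- For `n ≥ 1` and `0 < r < R` there is a real polynomial `p` in `n` variables
that is nonnegative on the annulus `{x : r ≤ ‖x‖ ≤ R}` (Euclidean norm) and whose Lebesgue
integral over the Euclidean ball `B_R(0)` is negative. -/
theorem stmt3 (n : ℕ) (hn : 1 ≤ n) (r R : ℝ) (hr : 0 < r) (hrR : r < R) :
    ∃ p : MvPolynomial (Fin n) ℝ,
      (∀ x : EuclideanSpace ℝ (Fin n), r ≤ ‖x‖ → ‖x‖ ≤ R →
        0 ≤ MvPolynomial.eval (fun i => x i) p) ∧
      (∫ x in Metric.ball (0 : EuclideanSpace ℝ (Fin n)) R,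
        MvPolynomial.eval (fun i => x i) p ∂volume) < 0 := by
  have hA : 0 < R ^ 2 - r ^ 2 / 4 := by nlinarith
  have hB : 0 ≤ R ^ 2 - r ^ 2 := by nlinarith
  set E := EuclideanSpace ℝ (Fin n)
  set v := volume.real (Metric.ball (0 : E) (r / 2))
  set V := volume.real (Metric.ball (0 : E) R)
  have hv : 0 < v := ENNReal.toReal_pos
    (Metric.measure_ball_pos volume _ (by positivity)).ne' measure_ball_lt_top.ne
  have hV : 0 ≤ V := measureReal_nonneg
  obtain ⟨k, hk⟩ : ∃ k : ℕ,
      R ^ 2 * V * ((R ^ 2 - r ^ 2) / (R ^ 2 - r ^ 2 / 4)) ^ k < 3 / 4 * r ^ 2 * v := by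
    have ht := (tendsto_pow_atTop_nhds_zero_of_lt_one (div_nonneg hB hA.le)
      ((div_lt_one hA).2 (by nlinarith))).const_mul (R ^ 2 * V)
    rw [mul_zero] at ht
    exact (ht.eventually_lt_const (by positivity)).exists
  let s : MvPolynomial (Fin n) ℝ := ∑ i, MvPolynomial.X i ^ 2
  let p : MvPolynomial (Fin n) ℝ := (s - MvPolynomial.C (r ^ 2)) *
    (MvPolynomial.C (R ^ 2 - r ^ 2 / 4)⁻¹ * (MvPolynomial.C (R ^ 2) - s)) ^ k
  have hp (x : E) : MvPolynomial.eval (fun i => x i) p =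
      (‖x‖ ^ 2 - r ^ 2) * ((R ^ 2 - ‖x‖ ^ 2) / (R ^ 2 - r ^ 2 / 4)) ^ k := by
    rw [EuclideanSpace.real_norm_sq_eq x]
    simp only [p, s, map_mul, map_sub, map_pow, map_sum, MvPolynomial.eval_X,
      MvPolynomial.eval_C, div_eq_inv_mul]
  refine ⟨p, fun x h₁ h₂ => ?_, ?_⟩
  · rw [hp]
    exact mul_nonneg (by nlinarith) (pow_nonneg (div_nonneg (by nlinarith) hA.le) _)
  simp_rw [hp]
  set a := (R ^ 2 - r ^ 2) / (R ^ 2 - r ^ 2 / 4)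
  have ha : 0 ≤ a := div_nonneg hB hA.le
  have hsub : Metric.ball (0 : E) (r / 2) ⊆ Metric.ball 0 R :=
    Metric.ball_subset_ball (by linarith)
  have hind : IntegrableOn ((Metric.ball (0 : E) (r / 2)).indicator
      fun _ => 3 / 4 * r ^ 2) (Metric.ball 0 R) volume :=
    (integrableOn_const measure_ball_lt_top.ne).indicator measurableSet_ball
  have hconst : IntegrableOn (fun _ : E => R ^ 2 * a ^ k) (Metric.ball 0 R) volume :=
    integrableOn_const measure_ball_lt_top.ne
  have hint : IntegrableOn (fun x : E =>
      (‖x‖ ^ 2 - r ^ 2) * ((R ^ 2 - ‖x‖ ^ 2) / (R ^ 2 - r ^ 2 / 4)) ^ k)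
      (Metric.ball 0 R) volume :=
    (ContinuousOn.integrableOn_compact (isCompact_closedBall 0 R)
      (by fun_prop)).mono_set Metric.ball_subset_closedBall
  calc
    _ ≤ ∫ x in Metric.ball (0 : E) R, (R ^ 2 * a ^ k -
        (Metric.ball (0 : E) (r / 2)).indicator (fun _ => 3 / 4 * r ^ 2) x) := by
      refine setIntegral_mono_on hint (hconst.sub hind) measurableSet_ball fun x hx => ?_
      rw [mem_ball_zero_iff] at hx
      have hx0 := norm_nonneg x
      have hRx : 0 ≤ (R ^ 2 - ‖x‖ ^ 2) / (R ^ 2 - r ^ 2 / 4) :=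
        div_nonneg (by nlinarith) hA.le
      have hak : 0 ≤ R ^ 2 * a ^ k := by positivity
      by_cases hxr : x ∈ Metric.ball (0 : E) (r / 2)
      · rw [Set.indicator_of_mem hxr]
        rw [mem_ball_zero_iff] at hxr
        have h1 : 1 ≤ ((R ^ 2 - ‖x‖ ^ 2) / (R ^ 2 - r ^ 2 / 4)) ^ k :=
          one_le_pow₀ ((one_le_div hA).2 (by nlinarith))
        have h2 : ‖x‖ ^ 2 ≤ r ^ 2 / 4 := by nlinarith
        nlinarith [mul_nonneg (by nlinarith : 0 ≤ r ^ 2 - ‖x‖ ^ 2) (sub_nonneg.2 h1)]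
      · rw [Set.indicator_of_notMem hxr, sub_zero]
        rcases le_total ‖x‖ r with h | h
        · exact (mul_nonpos_of_nonpos_of_nonneg (by nlinarith) (pow_nonneg hRx k)).trans hak
        · refine mul_le_mul (by nlinarith) (pow_le_pow_left₀ hRx ?_ k) (pow_nonneg hRx k)
            (by positivity)
          exact div_le_div_of_nonneg_right (by nlinarith) hA.le
    _ = R ^ 2 * V * a ^ k - 3 / 4 * r ^ 2 * v := by
      rw [integral_sub hconst hind, setIntegral_indicator measurableSet_ball,
        Set.inter_eq_right.2 hsub, setIntegral_const, setIntegral_const, smul_eq_mul,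
        smul_eq_mul]
      ring
    _ < 0 := sub_neg.2 hk
end

section
/- Let A ∈ ℝ^{N×M} be a matrix such that the kernel of Aᵀ is exactly the span of the all-ones vector 𝟙 ∈ ℝ^N (as holds for the full node-arc incidence matrix of a weakly connected digraph). Let b ∈ ℝ^N and let φ ∈ ℝ^M with φ_a > 0 for every a, and let Φ := diag(φ). Suppose (q¹, π¹) and (q², π²) both satisfy A q = b and Aᵀ π = −Φ F(q), where F(q)_a := q_a|q_a|. Then q¹ = q², and π¹ − π² is a scalar multiple of 𝟙; consequently the set of squared-pressure solutions is of the form {π* + η·𝟙 : η ∈ ℝ}. -/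
open Matrix in
theorem Matrix.dotProduct_transpose_mulVec_eq_zero {m n R : Type*} [Fintype m] [Fintype n]
    [CommRing R] {A : Matrix m n R} {v : n → R} (hv : A *ᵥ v = 0) (w : m → R) :
    v ⬝ᵥ (Aᵀ *ᵥ w) = 0 := by
  rw [dotProduct_mulVec, vecMul_transpose, hv, zero_dotProduct]

theorem strictMono_mul_abs_self : StrictMono fun x : ℝ => x * |x| := by
  intro x y hxy
  dsimp only
  rcases le_total 0 x with hx | hx <;> rcases le_total 0 y with hy | hy <;>
    simp only [abs_of_nonneg, abs_of_nonpos, hx, hy]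
  · nlinarith
  · linarith
  · rcases hx.lt_or_eq with h | h
    · nlinarith [mul_pos_of_neg_of_neg h h, mul_nonneg hy hy]
    · subst h; nlinarith
  · nlinarith

theorem StrictMono.sub_mul_sub_pos {f : ℝ → ℝ} (hf : StrictMono f) {x y : ℝ} (h : x ≠ y) :
    0 < (x - y) * (f x - f y) := by
  rcases h.lt_or_gt with h | h
  · exact mul_pos_of_neg_of_neg (sub_neg.2 h) (sub_neg.2 (hf h))
  · exact mul_pos (sub_pos.2 h) (sub_pos.2 (hf h))

/-- Let `A ∈ ℝ^{N×M}` with `ker Aᵀ = span 𝟙` (as for the full node-arc incidence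
matrix of a weakly connected digraph).  If `(q¹, π¹)` and `(q², π²)` both solve `A q = b`,
`Aᵀ π = −Φ F(q)` with `Φ = diag φ`, `φ > 0`, `F(q)_a = q_a |q_a|`, then `q¹ = q²` and
`π¹ − π²` is a scalar multiple of `𝟙`; moreover every `π¹ + η 𝟙` is again a solution, so the
squared-pressure solution set has the form `{π* + η 𝟙 : η ∈ ℝ}`. -/
theorem stmt11 (N M : ℕ) (A : Matrix (Fin N) (Fin M) ℝ)
    (hker : ∀ π : Fin N → ℝ, A.transpose.mulVec π = 0 ↔ ∃ c : ℝ, π = fun _ => c)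
    (b : Fin N → ℝ) (φ : Fin M → ℝ) (hφ : ∀ a, 0 < φ a)
    (q₁ q₂ : Fin M → ℝ) (π₁ π₂ : Fin N → ℝ)
    (hq₁ : A.mulVec q₁ = b)
    (hπ₁ : A.transpose.mulVec π₁ = fun a => -(φ a * (q₁ a * |q₁ a|)))
    (hq₂ : A.mulVec q₂ = b)
    (hπ₂ : A.transpose.mulVec π₂ = fun a => -(φ a * (q₂ a * |q₂ a|))) :
    q₁ = q₂ ∧ (∃ η : ℝ, π₁ - π₂ = fun _ => η) ∧
      ∀ η : ℝ, A.transpose.mulVec (fun i => π₁ i + η) =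
        fun a => -(φ a * (q₁ a * |q₁ a|)) := by
  have hq : q₁ = q₂ := by
    have hsum := Matrix.dotProduct_transpose_mulVec_eq_zero (A := A) (v := q₁ - q₂)
      (by rw [Matrix.mulVec_sub, hq₁, hq₂, sub_self]) (π₂ - π₁)
    rw [Matrix.mulVec_sub, hπ₁, hπ₂] at hsum
    by_contra hne
    obtain ⟨a, ha⟩ := Function.ne_iff.1 hne
    have hterm (i : Fin M) : (q₁ - q₂) i *
        ((fun a => -(φ a * (q₂ a * |q₂ a|))) - fun a => -(φ a * (q₁ a * |q₁ a|))) i =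
        φ i * ((q₁ i - q₂ i) * (q₁ i * |q₁ i| - q₂ i * |q₂ i|)) := by
      simp only [Pi.sub_apply]
      ring
    refine (Finset.sum_pos' (fun i _ => ?_) ⟨a, Finset.mem_univ a, ?_⟩).ne' hsum
    · rw [hterm]
      by_cases hi : q₁ i = q₂ i
      · simp [hi]
      · exact (mul_pos (hφ i) (strictMono_mul_abs_self.sub_mul_sub_pos hi)).le
    · rw [hterm]
      exact mul_pos (hφ a) (strictMono_mul_abs_self.sub_mul_sub_pos ha)
  subst hq
  refine ⟨rfl, (hker _).1 (by rw [Matrix.mulVec_sub, hπ₁, hπ₂, sub_self]), fun η => ?_⟩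
  change A.transpose.mulVec (π₁ + fun _ => η) = _
  rw [Matrix.mulVec_add, (hker _).2 ⟨η, rfl⟩, add_zero, hπ₁]
end

section
/- Let A ∈ ℝ^{N×M} be any matrix, let b ∈ ℝ^N lie in the column space of A, and let φ ∈ ℝ^M with φ_a > 0 for every a, Φ := diag(φ). Then there exist q ∈ ℝ^M and π ∈ ℝ^N satisfying A q = b and Aᵀ π = −Φ F(q), where F(q)_a := q_a|q_a|. In particular, for a balanced demand vector on a weakly connected network, a feasible flow exists for every strictly positive vector of pressure loss coefficients φ, defining a solution map φ ↦ q̃(φ) on ℝ_{>0}^M. -/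
open Matrix in
/-- A vector orthogonal to the kernel of a matrix lies in its row space. -/
theorem Matrix.exists_transpose_mulVec_eq_of_forall_ker {m n : Type*} [Fintype m] [Fintype n]
    {A : Matrix m n ℝ} {w : n → ℝ} (hw : ∀ v, A *ᵥ v = 0 → w ⬝ᵥ v = 0) :
    ∃ π : m → ℝ, Aᵀ *ᵥ π = w := by
  classical
  have hmem : dotProductBilin ℝ ℝ w ∈ LinearMap.range A.mulVecLin.dualMap := by
    rw [LinearMap.range_dualMap_eq_dualAnnihilator_ker, Submodule.mem_dualAnnihilator]
    intro v hv
    exact hw v (by simpa using hv)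
  obtain ⟨l, hl⟩ := hmem
  refine ⟨fun i => l (Pi.single i 1), funext fun a => ?_⟩
  have h := LinearMap.congr_fun hl (Pi.single a 1)
  simp only [LinearMap.dualMap_apply, mulVecLin_apply, mulVec_single_one,
    dotProductBilin_apply_apply, dotProduct_single_one] at h
  rw [← h, l.pi_apply_eq_sum_univ]
  refine Finset.sum_congr rfl fun i _ => ?_
  have hsingle : (fun j => if i = j then (1 : ℝ) else 0) = Pi.single i 1 := by
    ext j
    simp [Pi.single_apply, eq_comm]
  simp [hsingle]

/-- A weighted sum of cubed absolute values attains its minimum on every nonempty closed set. -/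
theorem exists_isMinOn_sum_mul_abs_cube {n : Type*} [Fintype n] {φ : n → ℝ}
    (hφ : ∀ a, 0 < φ a) {s : Set (n → ℝ)} (hs : IsClosed s) (hne : s.Nonempty) :
    ∃ q ∈ s, IsMinOn (fun q : n → ℝ => ∑ a, φ a * |q a| ^ 3) s q := by
  obtain ⟨q₀, hq₀⟩ := hne
  have hcont : Continuous fun q : n → ℝ => ∑ a, φ a * |q a| ^ 3 := by fun_prop
  refine hcont.continuousOn.exists_isMinOn' hs hq₀ (Filter.Eventually.filter_mono inf_le_left ?_)
  set c := ∑ a, φ a * |q₀ a| ^ 3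
  have hK : IsCompact (Set.univ.pi fun a => Set.Icc (-(1 + c / φ a)) (1 + c / φ a)) :=
    isCompact_univ_pi fun _ => isCompact_Icc
  filter_upwards [hK.compl_mem_cocompact] with x hx
  by_contra! hlt
  refine hx fun a _ => Set.mem_Icc.2 (abs_le.1 ?_)
  have hterm : ∀ a, 0 ≤ φ a * |x a| ^ 3 := fun a => mul_nonneg (hφ a).le (by positivity)
  have hle : φ a * |x a| ^ 3 ≤ c :=
    (Finset.single_le_sum (fun i _ => hterm i) (Finset.mem_univ a)).trans hlt.le
  have hcube : |x a| ^ 3 ≤ c / φ a := (le_div_iff₀' (hφ a)).2 hle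
  rcases le_total |x a| 1 with h | h
  · linarith [pow_nonneg (abs_nonneg (x a)) 3]
  · linarith [le_self_pow₀ h (n := 3) (by norm_num)]

theorem hasDerivAt_abs_cube (x : ℝ) : HasDerivAt (fun y : ℝ => |y| ^ 3) (3 * (x * |x|)) x := by
  have h := hasDerivAt_abs_rpow x (p := 3) (by norm_num)
  norm_num at h
  convert h using 1
  ring

open Matrix in
/-- First-order optimality for the weighted cubic energy on an affine subspace. -/
theorem sum_mul_abs_mul_eq_zero_of_isMinOn {m n : Type*} [Fintype n]
    {A : Matrix m n ℝ} {b : m → ℝ} {φ q v : n → ℝ} (hq : A *ᵥ q = b) (hv : A *ᵥ v = 0)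
    (hmin : IsMinOn (fun q : n → ℝ => ∑ a, φ a * |q a| ^ 3) {q | A *ᵥ q = b} q) :
    ∑ a, φ a * (q a * |q a|) * v a = 0 := by
  have hderiv : HasDerivAt (fun t : ℝ => ∑ a, φ a * |q a + t * v a| ^ 3)
      (∑ a, φ a * (3 * (q a * |q a|) * v a)) 0 := by
    refine HasDerivAt.fun_sum fun a _ => HasDerivAt.const_mul _ ?_
    have hline : HasDerivAt (fun t : ℝ => q a + t * v a) (v a) 0 := by
      simpa using ((hasDerivAt_id (0 : ℝ)).mul_const (v a)).const_add (q a)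
    exact HasDerivAt.comp_of_eq (0 : ℝ) (hasDerivAt_abs_cube (q a)) hline (by simp)
  have hloc : IsLocalMin (fun t : ℝ => ∑ a, φ a * |q a + t * v a| ^ 3) 0 := by
    refine Filter.Eventually.of_forall fun t => ?_
    have hmem : q + t • v ∈ {q | A *ᵥ q = b} := by
      simp [mulVec_add, mulVec_smul, hq, hv]
    simpa using hmin hmem
  have h := hloc.hasDerivAt_eq_zero hderiv
  have hscale : ∑ a, φ a * (3 * (q a * |q a|) * v a) = 3 * ∑ a, φ a * (q a * |q a|) * v a := by
    rw [Finset.mul_sum]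
    exact Finset.sum_congr rfl fun a _ => by ring
  linarith

/-- Let `A ∈ ℝ^{N×M}` be any matrix, let `b` lie in the column space of `A`,
and let `φ ∈ ℝ^M` be entrywise strictly positive, `Φ = diag φ`.  Then there exist `q ∈ ℝ^M`
and `π ∈ ℝ^N` with `A q = b` and `Aᵀ π = −Φ F(q)`, where `F(q)_a = q_a |q_a|`.  (In particular
a feasible flow exists for every strictly positive vector of pressure loss coefficients.) -/
theorem stmt12 (N M : ℕ) (A : Matrix (Fin N) (Fin M) ℝ) (b : Fin N → ℝ)
    (hb : ∃ q₀ : Fin M → ℝ, A.mulVec q₀ = b)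
    (φ : Fin M → ℝ) (hφ : ∀ a, 0 < φ a) :
    ∃ (q : Fin M → ℝ) (π : Fin N → ℝ),
      A.mulVec q = b ∧
      A.transpose.mulVec π = fun a => -(φ a * (q a * |q a|)) := by
  have hclosed : IsClosed {q : Fin M → ℝ | A.mulVec q = b} :=
    isClosed_eq (by fun_prop) continuous_const
  obtain ⟨q, hq, hmin⟩ := exists_isMinOn_sum_mul_abs_cube hφ hclosed hb
  obtain ⟨π, hπ⟩ := Matrix.exists_transpose_mulVec_eq_of_forall_ker
    (A := A) (w := fun a => -(φ a * (q a * |q a|))) fun v hv => by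
      simpa [dotProduct] using sum_mul_abs_mul_eq_zero_of_isMinOn hq hv hmin
  exact ⟨q, π, hq, hπ⟩
end
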